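/- arXiv:math/0304350 — 3 statements merged into one kernel-verified Lean document; each statement's English description precedes it below -/
import Mathlib

section
/- Let L_1, L_2 be simple closure spaces on Σ_1, Σ_2. The map f : L_1 × L_2 → L_1 ∨○ L_2, f(a_1, a_2) = a_1 × a_2, is a bimorphism, and it has the following universal property: for every simple closure space L and every bimorphism g : L_1 × L_2 → L (i.e. g(⋁ω, b) = ⋁_L {g(x,b) : x ∈ ω} for all ω ⊆ L_1, b ∈ L_2, and g(a, ⋁ω') = ⋁_L {g(a,y) : y ∈ ω'} for all a ∈ L_1, ω' ⊆ L_2), there exists a unique map h : L_1 ∨○ L_2 → L preserving arbitrary joins such that h(a_1 × a_2) = g(a_1, a_2) for all (a_1,a_2) ∈ L_1 × L_2. Hence ∨○ is a tensor product in the category of simple closure spaces with maps preserving arbitrary joins. -/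
open Set

namespace QLTensor

universe u v w

/-- A simple closure space on `X`: a set of subsets of `X`, closed under arbitrary
set-intersections, containing `∅`, `univ` and all singletons. -/
def IsSCS {X : Type*} (L : Set (Set X)) : Prop :=
  (∀ ω ⊆ L, ⋂₀ ω ∈ L) ∧ ∅ ∈ L ∧ Set.univ ∈ L ∧ ∀ p : X, ({p} : Set X) ∈ L

/-- The join in a simple closure space: `⋁ A = ⋂ {b ∈ L | A ⊆ b}`. -/
def cl {X : Type*} (L : Set (Set X)) (A : Set X) : Set X :=
  ⋂₀ {b | b ∈ L ∧ A ⊆ b}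

/-- `b` covers `a` in the lattice `L` (both belonging to `L`). -/
def CoversIn {X : Type*} (L : Set (Set X)) (a b : Set X) : Prop :=
  a ∈ L ∧ b ∈ L ∧ a ⊂ b ∧ ∀ c ∈ L, a ⊂ c → c ⊂ b → False

/-- `x` is a coatom of `L` (covered by the top element `univ`). -/
def IsCoatomIn {X : Type*} (L : Set (Set X)) (x : Set X) : Prop :=
  x ∈ L ∧ x ≠ Set.univ ∧ ∀ c ∈ L, x ⊂ c → c = Set.univ

/-- `L` is coatomistic: every element is an intersection of coatoms. -/
def Coatomistic {X : Type*} (L : Set (Set X)) : Prop :=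
  ∀ a ∈ L, a = ⋂₀ {x | IsCoatomIn L x ∧ a ⊆ x}

/-- The covering property: if `p ∧ a = 0` then `p ∨ a` covers `a`. -/
def CovProp {X : Type*} (L : Set (Set X)) : Prop :=
  ∀ p : X, ∀ a ∈ L, p ∉ a → CoversIn L a (cl L (insert p a))

/-- The covering property of the dual lattice. -/
def DualCovProp {X : Type*} (L : Set (Set X)) : Prop :=
  ∀ x : Set X, IsCoatomIn L x → ∀ a ∈ L, cl L (a ∪ x) = Set.univ →
    CoversIn L (a ∩ x) a

/-- A DAC-lattice: `L` and its dual are atomistic with the covering property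
(a simple closure space is automatically atomistic). -/
def IsDAC {X : Type*} (L : Set (Set X)) : Prop :=
  CovProp L ∧ Coatomistic L ∧ DualCovProp L

/-- `(a, b)` is a modular pair: `(c ∨ a) ∧ b = c ∨ (a ∧ b)` for all `c ≤ b`. -/
def ModularPairIn {X : Type*} (L : Set (Set X)) (a b : Set X) : Prop :=
  ∀ c ∈ L, c ⊆ b → cl L (c ∪ a) ∩ b = cl L (c ∪ a ∩ b)

/-- `z` is a central element of the simple closure space `L`. -/
def IsCentralIn {X : Type*} (L : Set (Set X)) (z : Set X) : Prop :=
  zᶜ ∈ L ∧ ModularPairIn L z zᶜ ∧ ModularPairIn L zᶜ z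

/-- `L` is irreducible: its only central elements are `∅` and `univ`. -/
def IrreducibleSCS {X : Type*} (L : Set (Set X)) : Prop :=
  ∀ z ∈ L, IsCentralIn L z → z = ∅ ∨ z = Set.univ

/-- `N` is an orthocomplementation of the simple closure space `L`. -/
def IsOrtho {X : Type*} (L : Set (Set X)) (N : Set X → Set X) : Prop :=
  (∀ a ∈ L, N a ∈ L) ∧ (∀ a ∈ L, N (N a) = a) ∧
  (∀ a ∈ L, ∀ b ∈ L, a ⊆ b → N b ⊆ N a) ∧
  ∀ a ∈ L, cl L (a ∪ N a) = Set.univ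

/-- `L` with orthocomplementation `N` is orthomodular. -/
def OrthomodularIn {X : Type*} (L : Set (Set X)) (N : Set X → Set X) : Prop :=
  ∀ a ∈ L, ∀ b ∈ L, a ⊆ b → b = cl L (a ∪ b ∩ N a)

/-- `L` contains `MO₃`. -/
def ContainsMO3 {X : Type*} (L : Set (Set X)) : Prop :=
  ∃ p q r : X, p ≠ q ∧ p ≠ r ∧ q ≠ r ∧
    CoversIn L {p} (cl L {p, q}) ∧ CoversIn L {q} (cl L {p, q}) ∧
    CoversIn L {r} (cl L {p, q})

/-- `L` contains `MO₄`. -/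
def ContainsMO4 {X : Type*} (L : Set (Set X)) : Prop :=
  ∃ p₁ p₂ p₃ p₄ : X,
    p₁ ≠ p₂ ∧ p₁ ≠ p₃ ∧ p₁ ≠ p₄ ∧ p₂ ≠ p₃ ∧ p₂ ≠ p₄ ∧ p₃ ≠ p₄ ∧
    CoversIn L {p₁} (cl L {p₁, p₄}) ∧ CoversIn L {p₂} (cl L {p₁, p₄}) ∧
    CoversIn L {p₃} (cl L {p₁, p₄}) ∧ CoversIn L {p₄} (cl L {p₁, p₄})

/-- `L` is connected. -/
def ConnectedSCS {X : Type*} (L : Set (Set X)) : Prop :=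
  (∃ p q : X, p ≠ q) ∧
  ∀ p q : X, p ≠ q → ∃ r : X, r ≠ p ∧ r ≠ q ∧ r ∈ cl L {p, q} ∧
    p ∈ cl L {q, r} ∧ q ∈ cl L {p, r}

/-- `L` is weakly connected: `L ≠ 2` and the point set admits a connected covering. -/
def WeaklyConnected {X : Type*} (L : Set (Set X)) : Prop :=
  (∃ p q : X, p ≠ q) ∧
  ∃ 𝒜 : Set (Set X),
    ⋃₀ 𝒜 = Set.univ ∧
    (∀ A ∈ 𝒜, ∃ p ∈ A, ∃ q ∈ A, p ≠ q) ∧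
    (∀ A ∈ 𝒜, ∀ p ∈ A, ∀ q ∈ A, p ≠ q → ∃ r, r ≠ p ∧ r ≠ q ∧ r ∈ cl L {p, q}) ∧
    ∀ p q : X, ∃ (m : ℕ) (c : Fin (m + 1) → Set X),
      (∀ i, c i ∈ 𝒜) ∧ p ∈ c 0 ∧ q ∈ c (Fin.last m) ∧
      ∀ i : Fin m, ∃ x ∈ c i.castSucc ∩ c i.succ, ∃ y ∈ c i.castSucc ∩ c i.succ, x ≠ y

/-- The central cover `e(p)` of an atom `p`. -/
def centralCover {X : Type*} (L : Set (Set X)) (p : X) : Set X :=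
  ⋂₀ {z | z ∈ L ∧ IsCentralIn L z ∧ p ∈ z}

/-- The interval `[0, e]` of `L`, viewed as a simple closure space on `e`. -/
def restrictSCS {X : Type*} (L : Set (Set X)) (e : Set X) : Set (Set ↥e) :=
  {B | Subtype.val '' B ∈ L}

/-- The automorphism group of `M` acts transitively on points. -/
def TransitiveSCS {X : Type*} (M : Set (Set X)) : Prop :=
  ∀ p q : X, ∃ u : X ≃ X, (∀ a : Set X, a ∈ M ↔ u '' a ∈ M) ∧ u p = q

section Pi

variable {Ω : Type*} {σ : Ω → Type*}

/-- `⋃_α π_α⁻¹ (a α)`. -/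
def unionCyl (a : ∀ α, Set (σ α)) : Set (∀ α, σ α) :=
  {p | ∃ α, p α ∈ a α}

/-- `∏_α a_α`. -/
def prodSet (a : ∀ α, Set (σ α)) : Set (∀ α, σ α) :=
  {p | ∀ α, p α ∈ a α}

/-- `p[A, β]`. -/
def cylSet (p : ∀ α, σ α) (β : Ω) (A : Set (σ β)) : Set (∀ α, σ α) :=
  {q | q β ∈ A ∧ ∀ α, α ≠ β → q α = p α}

/-- `R_β[p]`. -/
def secSet (R : Set (∀ α, σ α)) (β : Ω) (p : ∀ α, σ α) : Set (σ β) :=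
  {x | ∃ q ∈ R, q β = x ∧ ∀ α, α ≠ β → q α = p α}

/-- The separated product `∧○_α L_α`. -/
def wedgeO (L : ∀ α, Set (Set (σ α))) : Set (Set (∀ α, σ α)) :=
  {S | ∃ ω : Set (Set (∀ α, σ α)),
    (∀ y ∈ ω, ∃ a : ∀ α, Set (σ α), (∀ α, a α ∈ L α) ∧ y = unionCyl a) ∧ S = ⋂₀ ω}

/-- The product `∨○_α L_α`. -/
def veeO (L : ∀ α, Set (Set (σ α))) : Set (Set (∀ α, σ α)) :=
  {R | ∀ (β : Ω) (p : ∀ α, σ α), secSet R β p ∈ L β}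

/-- Axiom P2. -/
def AxiomP2 (L : ∀ α, Set (Set (σ α))) (M : Set (Set (∀ α, σ α))) : Prop :=
  ∀ a : ∀ α, Set (σ α), (∀ α, a α ∈ L α) → unionCyl a ∈ M

/-- Axiom P3. -/
def AxiomP3 (L : ∀ α, Set (Set (σ α))) (M : Set (Set (∀ α, σ α))) : Prop :=
  ∀ (p : ∀ α, σ α) (β : Ω) (A : Set (σ β)), cylSet p β A ∈ M → A ∈ L β

/-- `M` is a weak tensor product of the family `L`, i.e. `M ∈ S(L_α, α ∈ Ω)`. -/
def IsWTP (L : ∀ α, Set (Set (σ α))) (M : Set (Set (∀ α, σ α))) : Prop :=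
  IsSCS M ∧ AxiomP2 L M ∧ AxiomP3 L M

/-- `p # q` iff `p_β ⊥_β q_β` for some `β`. -/
def hashRel (N : ∀ α, Set (σ α) → Set (σ α)) (p q : ∀ α, σ α) : Prop :=
  ∃ β, p β ∈ N β {q β}

/-- `R^#`. -/
def sharp (N : ∀ α, Set (σ α) → Set (σ α)) (R : Set (∀ α, σ α)) :
    Set (∀ α, σ α) :=
  {q | ∀ p ∈ R, hashRel N q p}

/-- A join-preserving map `u` is large. -/
def LargeMap (u : Set (∀ α, σ α) → Set (∀ α, σ α)) : Prop :=
  ∀ (β : Ω) (p : ∀ α, σ α),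
    (¬ ∃ x, u (cylSet p β Set.univ) = {x}) ∧ ¬ u Set.univ ⊆ {q | q β = p β}

end Pi

section Binary

variable {X Y : Type*}

/-- The binary product `L₁ ∨○ L₂`. -/
def veeO2 (L1 : Set (Set X)) (L2 : Set (Set Y)) : Set (Set (X × Y)) :=
  {R | (∀ y : Y, {x | (x, y) ∈ R} ∈ L1) ∧ ∀ x : X, {y | (x, y) ∈ R} ∈ L2}

/-- The binary separated product `L₁ ∧○ L₂`. -/
def wedgeO2 (L1 : Set (Set X)) (L2 : Set (Set Y)) : Set (Set (X × Y)) :=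
  {S | ∃ ω : Set (Set (X × Y)),
    (∀ y ∈ ω, ∃ a₁ ∈ L1, ∃ a₂ ∈ L2,
      y = a₁ ×ˢ (Set.univ : Set Y) ∪ (Set.univ : Set X) ×ˢ a₂) ∧
    S = ⋂₀ ω}

end Binary

section Closure

variable {X : Type*} {Y : Type*} {Z : Type*} {L : Set (Set X)} {M : Set (Set Z)}

theorem subset_cl (L : Set (Set X)) (A : Set X) : A ⊆ cl L A :=
  subset_sInter fun _ hb => hb.2

theorem cl_subset {A b : Set X} (hb : b ∈ L) (h : A ⊆ b) : cl L A ⊆ b :=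
  sInter_subset_of_mem ⟨hb, h⟩

theorem cl_eq_self {a : Set X} (ha : a ∈ L) : cl L a = a :=
  (cl_subset ha Subset.rfl).antisymm (subset_cl L a)

theorem IsSCS.cl_mem (hL : IsSCS L) (A : Set X) : cl L A ∈ L :=
  hL.1 _ fun _ hb => hb.1

theorem IsSCS.singleton_mem (hL : IsSCS L) (p : X) : ({p} : Set X) ∈ L :=
  hL.2.2.2 p

/-- A map between families of sets preserves arbitrary joins. -/
def PreservesJoins (k : ↥L → ↥M) : Prop :=
  ∀ (ω : Set ↥L) (J : ↥L), (J : Set X) = cl L (⋃ x ∈ ω, (x : Set X)) →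
    (k J : Set Z) = cl M (⋃ x ∈ ω, (k x : Set Z))

theorem PreservesJoins.mono {k : ↥L → ↥M} (hk : PreservesJoins k) {a b : ↥L}
    (hab : (a : Set X) ⊆ b) : (k a : Set Z) ⊆ k b := by
  have h := hk {a, b} b (by
    rw [biUnion_pair, union_eq_self_of_subset_left hab, cl_eq_self b.2])
  rw [h, biUnion_pair]
  exact subset_union_left.trans (subset_cl M _)

/-- A join-preserving map is determined by its values on points. -/
theorem PreservesJoins.apply_cl {k : ↥L → ↥M} (hk : PreservesJoins k)
    (hs : ∀ p : X, ({p} : Set X) ∈ L) (A : Set X) {J : ↥L} (hJ : (J : Set X) = cl L A) :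
    (k J : Set Z) = cl M (⋃ p ∈ A, (k ⟨{p}, hs p⟩ : Set Z)) := by
  have h := hk ((fun p => (⟨{p}, hs p⟩ : ↥L)) '' A) J (by
    rw [biUnion_image, hJ]
    simp only [biUnion_of_singleton])
  rw [h, biUnion_image]

/-- The points sent below a closed set form a closed set. -/
theorem PreservesJoins.setOf_singleton_subset_mem {k : ↥L → ↥M} (hk : PreservesJoins k)
    (hL : IsSCS L) {m : Set Z} (hm : m ∈ M) :
    {p | (k ⟨{p}, hL.singleton_mem p⟩ : Set Z) ⊆ m} ∈ L := by
  set A := {p | (k ⟨{p}, hL.singleton_mem p⟩ : Set Z) ⊆ m}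
  have hJ : (k ⟨cl L A, hL.cl_mem A⟩ : Set Z) ⊆ m := by
    rw [hk.apply_cl hL.singleton_mem A rfl]
    exact cl_subset hm (iUnion₂_subset fun p hp => hp)
  have hA : cl L A = A := by
    refine Subset.antisymm (fun p hp => ?_) (subset_cl L A)
    exact (hk.mono (a := ⟨{p}, hL.singleton_mem p⟩) (b := ⟨cl L A, hL.cl_mem A⟩)
      (singleton_subset_iff.2 hp)).trans hJ
  exact hA ▸ hL.cl_mem A

variable {L1 : Set (Set X)} {L2 : Set (Set Y)}

theorem prod_mem_veeO2 (hL1 : ∅ ∈ L1) (hL2 : ∅ ∈ L2) {a₁ : Set X} (h₁ : a₁ ∈ L1)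
    {a₂ : Set Y} (h₂ : a₂ ∈ L2) : a₁ ×ˢ a₂ ∈ veeO2 L1 L2 := by
  refine ⟨fun y => ?_, fun x => ?_⟩
  · by_cases hy : y ∈ a₂ <;> simpa [hy]
  · by_cases hx : x ∈ a₁ <;> simpa [hx]

theorem cl_sUnion_prod (hL1 : IsSCS L1) (hL2 : IsSCS L2) {a₂ : Set Y} (h₂ : a₂ ∈ L2)
    (ω : Set (Set X)) :
    (cl L1 (⋃₀ ω)) ×ˢ a₂ = cl (veeO2 L1 L2) (⋃ x ∈ ω, x ×ˢ a₂) := by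
  refine Subset.antisymm ?_ (cl_subset
    (prod_mem_veeO2 hL1.2.1 hL2.2.1 (hL1.cl_mem _) h₂) (iUnion₂_subset fun x hx =>
      prod_mono ((subset_sUnion_of_mem hx).trans (subset_cl L1 _)) Subset.rfl))
  rintro ⟨p, q⟩ ⟨hp, hq⟩ R ⟨hR, hωR⟩
  exact cl_subset (hR.1 q)
    (sUnion_subset fun x hx r hr => hωR (mem_biUnion hx (mk_mem_prod hr hq))) hp

theorem prod_cl_sUnion (hL1 : IsSCS L1) (hL2 : IsSCS L2) {a₁ : Set X} (h₁ : a₁ ∈ L1)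
    (ω : Set (Set Y)) :
    a₁ ×ˢ (cl L2 (⋃₀ ω)) = cl (veeO2 L1 L2) (⋃ y ∈ ω, a₁ ×ˢ y) := by
  refine Subset.antisymm ?_ (cl_subset
    (prod_mem_veeO2 hL1.2.1 hL2.2.1 h₁ (hL2.cl_mem _)) (iUnion₂_subset fun y hy =>
      prod_mono Subset.rfl ((subset_sUnion_of_mem hy).trans (subset_cl L2 _))))
  rintro ⟨p, q⟩ ⟨hp, hq⟩ R ⟨hR, hωR⟩
  exact cl_subset (hR.2 p)
    (sUnion_subset fun y hy r hr => hωR (mem_biUnion hy (mk_mem_prod hp hr))) hq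

theorem existsUnique_preservesJoins_veeO2 (hL1 : IsSCS L1) (hL2 : IsSCS L2) (hM : IsSCS M)
    (g : ↥L1 → ↥L2 → ↥M) (hg₁ : ∀ b, PreservesJoins fun a => g a b)
    (hg₂ : ∀ a, PreservesJoins (g a)) :
    ∃! h : ↥(veeO2 L1 L2) → ↥M, PreservesJoins h ∧
      ∀ (a₁ : ↥L1) (a₂ : ↥L2) (R : ↥(veeO2 L1 L2)),
        (R : Set (X × Y)) = (a₁ : Set X) ×ˢ (a₂ : Set Y) → h R = g a₁ a₂ := by
  set f : X × Y → Set Z := fun p =>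
    g ⟨{p.1}, hL1.singleton_mem p.1⟩ ⟨{p.2}, hL2.singleton_mem p.2⟩
  have hf_mem : ∀ m ∈ M, {p | f p ⊆ m} ∈ veeO2 L1 L2 := fun m hm =>
    ⟨fun y => (hg₁ ⟨{y}, hL2.singleton_mem y⟩).setOf_singleton_subset_mem hL1 hm,
      fun x => (hg₂ ⟨{x}, hL1.singleton_mem x⟩).setOf_singleton_subset_mem hL2 hm⟩
  have hf_sub : ∀ R : Set (X × Y), ∀ p ∈ R, f p ⊆ cl M (⋃ p ∈ R, f p) := fun R p hp =>
    (subset_biUnion_of_mem (u := f) hp).trans (subset_cl M _)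
  refine ⟨fun R => ⟨cl M (⋃ p ∈ (R : Set (X × Y)), f p), hM.cl_mem _⟩, ⟨?_, ?_⟩, ?_⟩
  · intro ω J hJ
    refine Subset.antisymm (cl_subset (hM.cl_mem _) (iUnion₂_subset fun p hp => ?_))
      (cl_subset (hM.cl_mem _) (iUnion₂_subset fun R hR => cl_subset (hM.cl_mem _)
        (iUnion₂_subset fun p hp => hf_sub _ p ?_)))
    · rw [hJ] at hp
      refine cl_subset (hf_mem _ (hM.cl_mem _)) (iUnion₂_subset fun R hR q hq => ?_) hp
      exact (hf_sub _ q hq).trans ((subset_biUnion_of_mem (s := ω)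
        (u := fun R : ↥(veeO2 L1 L2) => cl M (⋃ p ∈ (R : Set (X × Y)), f p)) hR).trans
          (subset_cl M _))
    · rw [hJ]
      exact subset_cl _ _ (mem_biUnion hR hp)
  · intro a₁ a₂ R hR
    refine Subtype.ext (Subset.antisymm (cl_subset (g a₁ a₂).2 (iUnion₂_subset fun p hp => ?_)) ?_)
    · rw [hR] at hp
      exact ((hg₁ _).mono (singleton_subset_iff.2 hp.1)).trans
        ((hg₂ a₁).mono (singleton_subset_iff.2 hp.2))
    · rw [(hg₁ a₂).apply_cl hL1.singleton_mem a₁ (cl_eq_self a₁.2).symm]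
      refine cl_subset (hM.cl_mem _) (iUnion₂_subset fun x hx => ?_)
      rw [(hg₂ _).apply_cl hL2.singleton_mem a₂ (cl_eq_self a₂.2).symm]
      refine cl_subset (hM.cl_mem _) (iUnion₂_subset fun y hy => ?_)
      exact hf_sub _ (x, y) (hR ▸ mk_mem_prod hx hy)
  · rintro h ⟨hh, hhg⟩
    have hs : ∀ p : X × Y, ({p} : Set (X × Y)) ∈ veeO2 L1 L2 := fun p => by
      rw [← Prod.mk.eta (p := p), ← singleton_prod_singleton]
      exact prod_mem_veeO2 hL1.2.1 hL2.2.1 (hL1.singleton_mem _) (hL2.singleton_mem _)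
    have hhf : ∀ p, (h ⟨{p}, hs p⟩ : Set Z) = f p := fun p =>
      congrArg Subtype.val (hhg ⟨{p.1}, hL1.singleton_mem p.1⟩ ⟨{p.2}, hL2.singleton_mem p.2⟩ _
        singleton_prod_singleton.symm)
    funext R
    refine Subtype.ext ?_
    simp only [hh.apply_cl hs R (cl_eq_self R.2).symm, hhf]

end Closure

/-- `(a₁, a₂) ↦ a₁ × a₂` is a bimorphism `L₁ × L₂ → L₁ ∨○ L₂`, and it has
the universal property: every bimorphism `g : L₁ × L₂ → M` into a simple closure space
factors uniquely through it by a map preserving arbitrary joins.  Hence `∨○` is a tensor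
product in the category of simple closure spaces with join-preserving maps. -/
theorem stmt5 {X Y : Type*} [Nonempty X] [Nonempty Y]
    (L1 : Set (Set X)) (L2 : Set (Set Y)) (hL1 : IsSCS L1) (hL2 : IsSCS L2) :
    (∀ a₁ ∈ L1, ∀ a₂ ∈ L2, a₁ ×ˢ a₂ ∈ veeO2 L1 L2) ∧
    (∀ a₂ ∈ L2, ∀ ω ⊆ L1,
      (cl L1 (⋃₀ ω)) ×ˢ a₂ = cl (veeO2 L1 L2) (⋃ x ∈ ω, x ×ˢ a₂)) ∧
    (∀ a₁ ∈ L1, ∀ ω ⊆ L2,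
      a₁ ×ˢ (cl L2 (⋃₀ ω)) = cl (veeO2 L1 L2) (⋃ y ∈ ω, a₁ ×ˢ y)) ∧
    ∀ (Z : Type w) (M : Set (Set Z)), IsSCS M →
      ∀ g : ↥L1 → ↥L2 → ↥M,
      (∀ (ω : Set ↥L1) (J : ↥L1) (b : ↥L2),
        (J : Set X) = cl L1 (⋃ x ∈ ω, (x : Set X)) →
        (g J b : Set Z) = cl M (⋃ x ∈ ω, ((g x b : Set Z)))) →
      (∀ (ω : Set ↥L2) (a : ↥L1) (J : ↥L2),
        (J : Set Y) = cl L2 (⋃ y ∈ ω, (y : Set Y)) →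
        (g a J : Set Z) = cl M (⋃ y ∈ ω, ((g a y : Set Z)))) →
      ∃! h : ↥(veeO2 L1 L2) → ↥M,
        (∀ (ω : Set ↥(veeO2 L1 L2)) (J : ↥(veeO2 L1 L2)),
          (J : Set (X × Y)) = cl (veeO2 L1 L2) (⋃ R ∈ ω, (R : Set (X × Y))) →
          (h J : Set Z) = cl M (⋃ R ∈ ω, ((h R : Set Z)))) ∧
        ∀ (a₁ : ↥L1) (a₂ : ↥L2) (R : ↥(veeO2 L1 L2)),
          (R : Set (X × Y)) = (a₁ : Set X) ×ˢ (a₂ : Set Y) → h R = g a₁ a₂ := by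
  exact ⟨fun _ h₁ _ h₂ => prod_mem_veeO2 hL1.2.1 hL2.2.1 h₁ h₂,
    fun _ h₂ ω _ => cl_sUnion_prod hL1 hL2 h₂ ω,
    fun _ h₁ ω _ => prod_cl_sUnion hL1 hL2 h₁ ω,
    fun _ _ hM g hg₁ hg₂ => existsUnique_preservesJoins_veeO2 hL1 hL2 hM g
      (fun b ω J hJ => hg₁ ω J b hJ) (fun a ω J hJ => hg₂ ω a J hJ)⟩

end QLTensor
end

section
/- Let {L_α}_{α∈Ω} be simple closure spaces, L_α on Σ_α, and 𝚺 = ∏_α Σ_α. If there exists β ∈ Ω such that L_α = 2^{Σ_α} for all α ≠ β (i.e. at most one factor is not a power set), then ∧○_α L_α = ∨○_α L_α = {R ⊆ 𝚺 : R_β[p] ∈ L_β for all p ∈ 𝚺}. -/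
open Set

namespace QLTensor

universe u v w

section Sections

variable {Ω : Type*} {σ : Ω → Type*}

open Classical in
theorem mem_secSet_iff_update_mem {R : Set (∀ α, σ α)} {β : Ω} {p : ∀ α, σ α} {x : σ β} :
    x ∈ secSet R β p ↔ Function.update p β x ∈ R := by
  constructor
  · rintro ⟨q, hq, rfl, hqp⟩
    have h : Function.update p β (q β) = q := by
      funext α
      by_cases hα : α = β
      · subst hα
        simp
      · simp [hα, hqp α hα]
    rwa [h]
  · intro h
    exact ⟨_, h, by simp, fun α hα => by simp [hα]⟩

theorem secSet_sInter (ω : Set (Set (∀ α, σ α))) (β : Ω) (p : ∀ α, σ α) :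
    secSet (⋂₀ ω) β p = ⋂₀ ((fun y => secSet y β p) '' ω) := by
  ext x
  simp [mem_secSet_iff_update_mem]

theorem secSet_unionCyl (a : ∀ α, Set (σ α)) (β : Ω) (p : ∀ α, σ α) :
    secSet (unionCyl a) β p = Set.univ ∨ secSet (unionCyl a) β p = a β := by
  by_cases h : ∃ α, α ≠ β ∧ p α ∈ a α
  · obtain ⟨α, hα, hp⟩ := h
    left
    ext x
    simp only [mem_secSet_iff_update_mem, Set.mem_univ, iff_true]
    exact ⟨α, by simpa [hα] using hp⟩
  · right
    ext x
    rw [mem_secSet_iff_update_mem]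
    constructor
    · rintro ⟨α, hα⟩
      by_cases hαβ : α = β
      · subst hαβ
        simpa using hα
      · exact absurd ⟨α, hαβ, by simpa [hαβ] using hα⟩ h
    · intro hx
      exact ⟨β, by simpa using hx⟩

theorem wedgeO_subset_veeO {L : ∀ α, Set (Set (σ α))} (hL : ∀ α, IsSCS (L α)) :
    wedgeO L ⊆ veeO L := by
  rintro S ⟨ω, hω, rfl⟩ β p
  rw [secSet_sInter]
  apply (hL β).1
  rintro _ ⟨y, hy, rfl⟩
  obtain ⟨a, ha, rfl⟩ := hω y hy
  rcases secSet_unionCyl a β p with h | h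
  · simpa only [h] using (hL β).2.2.1
  · simpa only [h] using ha β

theorem exists_unionCyl_separating (R : Set (∀ α, σ α)) (β : Ω) {p : ∀ α, σ α} (hp : p ∉ R) :
    ∃ a : ∀ α, Set (σ α), a β = secSet R β p ∧ R ⊆ unionCyl a ∧ p ∉ unionCyl a := by
  classical
  refine ⟨Function.update (fun α => {p α}ᶜ) β (secSet R β p), by simp, fun q hq => ?_, ?_⟩
  · by_cases h : ∃ α, α ≠ β ∧ q α ≠ p α
    · obtain ⟨α, hα, hqp⟩ := h
      exact ⟨α, by simpa [hα] using hqp⟩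
    · push Not at h
      have hqβ : q β ∈ secSet R β p := ⟨q, hq, rfl, h⟩
      exact ⟨β, by simpa only [Function.update_self] using hqβ⟩
  · rintro ⟨α, hα⟩
    by_cases hαβ : α = β
    · subst hαβ
      simp [mem_secSet_iff_update_mem, hp] at hα
    · simp [hαβ] at hα

theorem mem_wedgeO_of_forall_secSet_mem {L : ∀ α, Set (Set (σ α))} {β : Ω}
    (hpow : ∀ α, α ≠ β → L α = Set.univ) {R : Set (∀ α, σ α)}
    (hR : ∀ p, secSet R β p ∈ L β) : R ∈ wedgeO L := by
  refine ⟨{y | (∃ a : ∀ α, Set (σ α), (∀ α, a α ∈ L α) ∧ y = unionCyl a) ∧ R ⊆ y},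
    fun y hy => hy.1, Set.Subset.antisymm (fun q hq y hy => hy.2 hq) fun p hp => ?_⟩
  by_contra hpR
  obtain ⟨a, haβ, hRa, hpa⟩ := exists_unionCyl_separating R β hpR
  refine hpa (hp _ ⟨⟨a, fun α => ?_, rfl⟩, hRa⟩)
  by_cases hα : α = β
  · subst hα
    exact haβ ▸ hR p
  · simp [hpow α hα]

end Sections

/-- if all factors except possibly `L_β` are power sets, then
`∧○_α L_α = ∨○_α L_α = {R | R_β[p] ∈ L_β for all p}`. -/
theorem stmt6 {Ω : Type*} {σ : Ω → Type*} [∀ α, Nonempty (σ α)]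
    (L : ∀ α, Set (Set (σ α))) (hL : ∀ α, IsSCS (L α))
    (β : Ω) (hpow : ∀ α, α ≠ β → L α = (Set.univ : Set (Set (σ α)))) :
    wedgeO L = {R : Set (∀ α, σ α) | ∀ p : ∀ α, σ α, secSet R β p ∈ L β} ∧
    veeO L = {R : Set (∀ α, σ α) | ∀ p : ∀ α, σ α, secSet R β p ∈ L β} := by
  have hwv := wedgeO_subset_veeO hL
  exact ⟨Set.Subset.antisymm (fun R hR => hwv hR β)
      fun R hR => mem_wedgeO_of_forall_secSet_mem hpow hR,
    Set.Subset.antisymm (fun R hR => hR β)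
      fun R hR => hwv (mem_wedgeO_of_forall_secSet_mem hpow hR)⟩

end QLTensor
end

section
/- Let L_1 and L_2 be simple closure spaces on Σ_1 and Σ_2. If both L_1 and L_2 contain MO_3 (i.e. for i = 1, 2 there exist three distinct atoms p_i, q_i, r_i of L_i such that p_i ∨ q_i covers each of p_i, q_i and r_i), then L_1 ∧○ L_2 ≠ L_1 ∨○ L_2. -/
open Set

namespace QLTensor

universe u v w

section PointLemmas

variable {X : Type*} {L : Set (Set X)}

theorem IsSCS.inter_mem (hL : IsSCS L) {a b : Set X} (ha : a ∈ L) (hb : b ∈ L) : a ∩ b ∈ L := by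
  rw [← sInter_pair]
  exact hL.1 _ (pair_subset ha hb)

theorem IsSCS.mem_of_subsingleton (hL : IsSCS L) {a : Set X} (ha : a.Subsingleton) : a ∈ L := by
  obtain rfl | ⟨x, rfl⟩ := ha.eq_empty_or_singleton
  · exact hL.2.1
  · exact hL.2.2.2 x

/-- An element of `L` containing an atom covered by `b` and a second point of `b` contains `b`. -/
theorem CoversIn.subset_of_mem (hL : IsSCS L) {s t : X} {a b : Set X} (h : CoversIn L {s} b)
    (ha : a ∈ L) (htb : t ∈ b) (hst : s ≠ t) (hsa : s ∈ a) (hta : t ∈ a) : b ⊆ a := by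
  by_contra hba
  have hs : s ∈ b := h.2.2.1.subset rfl
  refine h.2.2.2 (a ∩ b) (hL.inter_mem ha h.2.1) ?_ ?_
  · exact ⟨singleton_subset_iff.2 ⟨hsa, hs⟩, fun hsub => hst (hsub ⟨hta, htb⟩).symm⟩
  · exact ⟨inter_subset_right, fun hsub => hba fun x hx => (hsub hx).1⟩

/-- Three distinct points as in `MO₃`: any element of `L` containing two of them contains all. -/
theorem ContainsMO3.exists_points (hL : IsSCS L) (h : ContainsMO3 L) :
    ∃ p q r : X, p ≠ q ∧ p ≠ r ∧ q ≠ r ∧ ∀ a ∈ L,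
      (p ∈ a ∧ q ∈ a) ∨ (p ∈ a ∧ r ∈ a) ∨ (q ∈ a ∧ r ∈ a) → p ∈ a ∧ q ∈ a ∧ r ∈ a := by
  obtain ⟨p, q, r, hpq, hpr, hqr, hp, hq, hr⟩ := h
  have hpb := hp.2.2.1.subset rfl
  have hqb := hq.2.2.1.subset rfl
  have hrb := hr.2.2.1.subset rfl
  refine ⟨p, q, r, hpq, hpr, hqr, fun a ha hpair => ?_⟩
  have hba : cl L {p, q} ⊆ a := by
    rcases hpair with ⟨h₁, h₂⟩ | ⟨h₁, h₂⟩ | ⟨h₁, h₂⟩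
    · exact hp.subset_of_mem hL ha hqb hpq h₁ h₂
    · exact hp.subset_of_mem hL ha hrb hpr h₁ h₂
    · exact hq.subset_of_mem hL ha hrb hqr h₁ h₂
  exact ⟨hba hpb, hba hqb, hba hrb⟩

end PointLemmas

/-- if both `L₁` and `L₂` contain `MO₃`, then `L₁ ∧○ L₂ ≠ L₁ ∨○ L₂`. -/
theorem stmt7 {X Y : Type*} [Nonempty X] [Nonempty Y]
    (L1 : Set (Set X)) (L2 : Set (Set Y)) (hL1 : IsSCS L1) (hL2 : IsSCS L2)
    (h1 : ContainsMO3 L1) (h2 : ContainsMO3 L2) :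
    wedgeO2 L1 L2 ≠ veeO2 L1 L2 := by
  obtain ⟨p₁, q₁, r₁, hpq₁, hpr₁, hqr₁, hall₁⟩ := h1.exists_points hL1
  obtain ⟨p₂, q₂, r₂, hpq₂, hpr₂, hqr₂, hall₂⟩ := h2.exists_points hL2
  intro heq
  have hvee : ({(p₁, p₂), (q₁, q₂), (r₁, r₂)} : Set (X × Y)) ∈ veeO2 L1 L2 := by
    constructor
    · refine fun y => hL1.mem_of_subsingleton fun a ha b hb => ?_
      simp only [mem_ofPred_eq, mem_insert_iff, mem_singleton_iff, Prod.mk.injEq] at ha hb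
      grind
    · refine fun x => hL2.mem_of_subsingleton fun a ha b hb => ?_
      simp only [mem_ofPred_eq, mem_insert_iff, mem_singleton_iff, Prod.mk.injEq] at ha hb
      grind
  rw [← heq] at hvee
  obtain ⟨ω, hω, hR⟩ := hvee
  have hmem : (p₁, q₂) ∈ ⋂₀ ω := by
    intro y hy
    have hsub : {(p₁, p₂), (q₁, q₂), (r₁, r₂)} ⊆ y := hR ▸ sInter_subset_of_mem hy
    obtain ⟨a₁, ha₁, a₂, ha₂, rfl⟩ := hω y hy
    simp only [insert_subset_iff, singleton_subset_iff, mem_union, mem_prod, mem_univ,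
      and_true, true_and] at hsub ⊢
    have := hall₁ a₁ ha₁
    have := hall₂ a₂ ha₂
    tauto
  rw [← hR] at hmem
  simp only [mem_insert_iff, mem_singleton_iff, Prod.mk.injEq] at hmem
  grind

end QLTensor
end
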